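/- arXiv:2506.06613 — 2 statements merged into one kernel-verified Lean document; each statement's English description precedes it below -/
import Mathlib

section
/- Let d ∈ ℕ, σ₀ > 0, and let p be the density of the Gaussian N(μ₁, σ₁² I_d) and q the density of N(μ₂, σ₂² I_d) with μ₁, μ₂ ∈ ℝ^d and σ₁, σ₂ ≥ σ₀. Let P, Q be the Fourier transforms of p, q. Then for every α > (1/σ₀)·√((d+4) log 2), one has (1/(2π)^d) ∫_{‖w‖₂ ≥ α} |P(w) − Q(w)|² dw ≤ 2^{(d/2 + 2)} e^{−σ₀² α² / 2} ‖p − q‖₂². -/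
open MeasureTheory Real

/-- Fourier transform with the convention `F{f}(w) = ∫ f(x) e^{-i⟨x,w⟩} dx`. -/
noncomputable def fourierTf {d : ℕ} (f : EuclideanSpace ℝ (Fin d) → ℝ)
    (w : EuclideanSpace ℝ (Fin d)) : ℂ :=
  ∫ x, (f x : ℂ) * Complex.exp (-Complex.I * ((@inner ℝ _ _ x w : ℝ) : ℂ))

/-- Density of the isotropic Gaussian `N(μ, σ² I_d)` on `ℝ^d`. -/
noncomputable def gaussPdf {d : ℕ} (μ : EuclideanSpace ℝ (Fin d)) (σ : ℝ)
    (x : EuclideanSpace ℝ (Fin d)) : ℝ :=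
  (2 * π * σ ^ 2) ^ (-(d : ℝ) / 2) * Real.exp (-‖x - μ‖ ^ 2 / (2 * σ ^ 2))


theorem aux_real {d : ℕ} (β γ : ℝ) (hβ : 0 < β) (v : EuclideanSpace ℝ (Fin d)) :
    Integrable (fun x : EuclideanSpace ℝ (Fin d) => Real.exp (-β * ‖x‖ ^ 2 + γ * @inner ℝ _ _ v x)) ∧
    ∫ x : EuclideanSpace ℝ (Fin d), Real.exp (-β * ‖x‖ ^ 2 + γ * @inner ℝ _ _ v x)
      = (π / β) ^ ((d : ℝ) / 2) * Real.exp (γ ^ 2 * ‖v‖ ^ 2 / (4 * β)) := by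
  have hb : 0 < (β : ℂ).re := by simpa using hβ
  have h1 := GaussianFourier.integrable_cexp_neg_mul_sq_norm_add hb (γ : ℂ) v
  have h2 := GaussianFourier.integral_cexp_neg_mul_sq_norm_add hb (γ : ℂ) v
  have e : ∀ x : EuclideanSpace ℝ (Fin d),
      Complex.exp (-(β : ℂ) * ‖x‖ ^ 2 + (γ : ℂ) * ((@inner ℝ _ _ v x : ℝ) : ℂ))
      = ((Real.exp (-β * ‖x‖ ^ 2 + γ * @inner ℝ _ _ v x) : ℝ) : ℂ) := by
    intro x; push_cast; rfl
  constructor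
  · have := h1.re
    refine this.congr (Filter.Eventually.of_forall fun x => ?_)
    simp only [e]
    exact Complex.ofReal_re _
  · simp_rw [e] at h2
    rw [integral_complex_ofReal] at h2
    apply Complex.ofReal_injective
    rw [h2, Complex.ofReal_mul, Complex.ofReal_cpow (by positivity)]
    push_cast
    simp

theorem aux_cos {d : ℕ} (β : ℝ) (hβ : 0 < β) (v : EuclideanSpace ℝ (Fin d)) :
    Integrable (fun x : EuclideanSpace ℝ (Fin d) => Real.exp (-β * ‖x‖ ^ 2) * Real.cos (@inner ℝ _ _ v x)) ∧
    ∫ x : EuclideanSpace ℝ (Fin d), Real.exp (-β * ‖x‖ ^ 2) * Real.cos (@inner ℝ _ _ v x)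
      = (π / β) ^ ((d : ℝ) / 2) * Real.exp (-‖v‖ ^ 2 / (4 * β)) := by
  have hb : 0 < (β : ℂ).re := by simpa using hβ
  have h1 := GaussianFourier.integrable_cexp_neg_mul_sq_norm_add hb Complex.I v
  have h2 := GaussianFourier.integral_cexp_neg_mul_sq_norm_add hb Complex.I v
  have e : ∀ x : EuclideanSpace ℝ (Fin d),
      (Complex.exp (-(β : ℂ) * ‖x‖ ^ 2 + Complex.I * ((@inner ℝ _ _ v x : ℝ) : ℂ))).re
      = Real.exp (-β * ‖x‖ ^ 2) * Real.cos (@inner ℝ _ _ v x) := by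
    intro x
    have : -(β : ℂ) * ‖x‖ ^ 2 = ((-β * ‖x‖ ^ 2 : ℝ) : ℂ) := by push_cast; rfl
    rw [this, Complex.exp_re]
    simp only [Complex.add_re, Complex.add_im, Complex.ofReal_re, Complex.ofReal_im,
      Complex.re_mul_ofReal, Complex.im_mul_ofReal, Complex.I_re, Complex.I_im]
    simp
  constructor
  · have := h1.re
    refine this.congr (Filter.Eventually.of_forall fun x => ?_)
    exact e x
  · have h3 := integral_re h1
    simp only [RCLike.re_eq_complex_re] at h3
    simp_rw [e] at h3
    rw [h3, h2]
    have : ((π : ℂ) / β) ^ ((Module.finrank ℝ (EuclideanSpace ℝ (Fin d)) : ℂ) / 2)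
        * Complex.exp (Complex.I ^ 2 * ‖v‖ ^ 2 / (4 * β))
        = (((π / β) ^ ((d : ℝ) / 2) * Real.exp (-‖v‖ ^ 2 / (4 * β)) : ℝ) : ℂ) := by
      rw [Complex.ofReal_mul, Complex.ofReal_cpow (by positivity)]
      push_cast
      simp
    rw [this, Complex.ofReal_re]

theorem aux_exp {d : ℕ} (β : ℝ) (hβ : 0 < β) :
    Integrable (fun x : EuclideanSpace ℝ (Fin d) => Real.exp (-β * ‖x‖ ^ 2)) ∧
    ∫ x : EuclideanSpace ℝ (Fin d), Real.exp (-β * ‖x‖ ^ 2) = (π / β) ^ ((d : ℝ) / 2) := by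
  simpa using aux_real (d := d) β 0 hβ 0

theorem aux_prod {d : ℕ} (μ₁ μ₂ : EuclideanSpace ℝ (Fin d)) (s t : ℝ) (hs : 0 < s) (ht : 0 < t) :
    Integrable (fun x => gaussPdf μ₁ s x * gaussPdf μ₂ t x) ∧
    ∫ x, gaussPdf μ₁ s x * gaussPdf μ₂ t x
      = 1 / (2 * π) ^ d * ((π / ((s ^ 2 + t ^ 2) / 2)) ^ ((d : ℝ) / 2)
        * Real.exp (-‖μ₁ - μ₂‖ ^ 2 / (4 * ((s ^ 2 + t ^ 2) / 2)))) := by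
  set β : ℝ := 1 / (2 * s ^ 2) + 1 / (2 * t ^ 2) with hβd
  have hβ : 0 < β := by positivity
  obtain ⟨h1, h2⟩ := aux_real β (-1 / t ^ 2) hβ (μ₁ - μ₂)
  set K : ℝ := (2 * π * s ^ 2) ^ (-(d : ℝ) / 2) * (2 * π * t ^ 2) ^ (-(d : ℝ) / 2)
    * Real.exp (-‖μ₁ - μ₂‖ ^ 2 / (2 * t ^ 2)) with hK
  have e : ∀ x, gaussPdf μ₁ s (x + μ₁) * gaussPdf μ₂ t (x + μ₁)
      = K * Real.exp (-β * ‖x‖ ^ 2 + (-1 / t ^ 2) * @inner ℝ _ _ (μ₁ - μ₂) x) := by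
    intro x
    have hn : ‖x + μ₁ - μ₂‖ ^ 2
        = ‖x‖ ^ 2 + 2 * @inner ℝ _ _ (μ₁ - μ₂) x + ‖μ₁ - μ₂‖ ^ 2 := by
      rw [add_sub_assoc, norm_add_sq_real, real_inner_comm]
    simp only [gaussPdf, add_sub_cancel_right, hn, hK]
    rw [mul_mul_mul_comm, mul_assoc (_ * _), ← Real.exp_add, ← Real.exp_add]
    congr 2
    rw [hβd]; field_simp; ring
  constructor
  · have := (h1.const_mul K)
    simp_rw [← e] at this
    have h := this.comp_sub_right μ₁
    simpa using h
  · rw [← integral_add_right_eq_self _ μ₁]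
    simp_rw [e]
    rw [integral_const_mul, h2, hK]
    have hE : Real.exp (-‖μ₁ - μ₂‖ ^ 2 / (2 * t ^ 2))
        * Real.exp ((-1 / t ^ 2) ^ 2 * ‖μ₁ - μ₂‖ ^ 2 / (4 * β))
        = Real.exp (-‖μ₁ - μ₂‖ ^ 2 / (4 * ((s ^ 2 + t ^ 2) / 2))) := by
      rw [← Real.exp_add]; congr 1; rw [hβd]; field_simp; ring
    have hC : (2 * π * s ^ 2) ^ (-(d : ℝ) / 2) * (2 * π * t ^ 2) ^ (-(d : ℝ) / 2)
        * (π / β) ^ ((d : ℝ) / 2)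
        = 1 / (2 * π) ^ d * (π / ((s ^ 2 + t ^ 2) / 2)) ^ ((d : ℝ) / 2) := by
      have hd : 1 / (2 * π) ^ d = ((1 / (2 * π) ^ 2 : ℝ)) ^ ((d : ℝ) / 2) := by
        rw [Real.div_rpow (by positivity) (by positivity), Real.one_rpow,
          ← Real.rpow_natCast (2 * π) 2, ← Real.rpow_mul (by positivity),
          ← Real.rpow_natCast (2 * π) d]
        congr 2; push_cast; ring
      have hi : ∀ y : ℝ, 0 < y → y ^ (-(d : ℝ) / 2) = (1 / y) ^ ((d : ℝ) / 2) := by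
        intro y hy
        rw [one_div, neg_div, Real.rpow_neg hy.le, Real.inv_rpow hy.le]
      rw [hd, hi _ (by positivity), hi _ (by positivity),
        ← Real.mul_rpow (by positivity) (by positivity),
        ← Real.mul_rpow (by positivity) (by positivity),
        ← Real.mul_rpow (by positivity) (by positivity)]
      congr 1
      rw [hβd]; field_simp; ring
    rw [← hE, ← mul_assoc (1 / (2 * π) ^ d), ← hC]
    ring

theorem aux_ft {d : ℕ} (μ w : EuclideanSpace ℝ (Fin d)) (s : ℝ) (hs : 0 < s) :
    fourierTf (gaussPdf μ s) w
      = ((Real.exp (-s ^ 2 * ‖w‖ ^ 2 / 2) : ℝ) : ℂ)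
        * Complex.exp (((-@inner ℝ _ _ μ w : ℝ) : ℂ) * Complex.I) := by
  have hβ : 0 < (((1 / (2 * s ^ 2) : ℝ)) : ℂ).re := by
    rw [Complex.ofReal_re]; positivity
  have h2 := GaussianFourier.integral_cexp_neg_mul_sq_norm_add hβ (-Complex.I) w
  unfold fourierTf
  rw [← integral_add_right_eq_self _ μ]
  have e : ∀ x, (gaussPdf μ s (x + μ) : ℂ)
      * Complex.exp (-Complex.I * ((@inner ℝ _ _ (x + μ) w : ℝ) : ℂ))
      = (((2 * π * s ^ 2) ^ (-(d : ℝ) / 2) : ℝ) : ℂ)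
        * Complex.exp (((-@inner ℝ _ _ μ w : ℝ) : ℂ) * Complex.I) *
        Complex.exp (-((1 / (2 * s ^ 2) : ℝ) : ℂ) * ‖x‖ ^ 2
          + -Complex.I * ((@inner ℝ _ _ w x : ℝ) : ℂ)) := by
    intro x
    rw [gaussPdf, Complex.ofReal_mul, Complex.ofReal_exp, mul_assoc (Complex.ofReal _),
      mul_assoc (Complex.ofReal _), ← Complex.exp_add,
      ← Complex.exp_add, inner_add_left, real_inner_comm x w, add_sub_cancel_right]
    congr 2
    push_cast
    ring
  simp_rw [e]
  rw [integral_const_mul, h2]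
  have hc : (((2 * π * s ^ 2) ^ (-(d : ℝ) / 2) : ℝ) : ℂ)
      * ((π : ℂ) / ((1 / (2 * s ^ 2) : ℝ) : ℂ)) ^
        ((Module.finrank ℝ (EuclideanSpace ℝ (Fin d)) : ℂ) / 2) = 1 := by
    have : ((π : ℂ) / ((1 / (2 * s ^ 2) : ℝ) : ℂ)) ^
        ((Module.finrank ℝ (EuclideanSpace ℝ (Fin d)) : ℂ) / 2)
        = (((2 * π * s ^ 2) ^ ((d : ℝ) / 2) : ℝ) : ℂ) := by
      rw [Complex.ofReal_cpow (by positivity)]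
      push_cast
      simp only [finrank_euclideanSpace, Fintype.card_fin]
      congr 1
      have : (s : ℂ) ≠ 0 := by exact_mod_cast hs.ne'
      field_simp
    rw [this, ← Complex.ofReal_mul, ← Real.rpow_add (by positivity)]
    simp [neg_div]
  have hx : Complex.exp ((-Complex.I) ^ 2 * ‖w‖ ^ 2 / (4 * ((1 / (2 * s ^ 2) : ℝ) : ℂ)))
      = ((Real.exp (-s ^ 2 * ‖w‖ ^ 2 / 2) : ℝ) : ℂ) := by
    rw [Complex.ofReal_exp]
    congr 1
    have : (s : ℂ) ≠ 0 := by exact_mod_cast hs.ne'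
    push_cast
    rw [neg_sq, Complex.I_sq]
    field_simp
    ring
  rw [hx]
  linear_combination (((Real.exp (-s ^ 2 * ‖w‖ ^ 2 / 2) : ℝ) : ℂ)
        * Complex.exp (((-@inner ℝ _ _ μ w : ℝ) : ℂ) * Complex.I)) * hc

theorem aux_polar (a b u v : ℝ) :
    ‖(a : ℂ) * Complex.exp ((u : ℂ) * Complex.I) - (b : ℂ) * Complex.exp ((v : ℂ) * Complex.I)‖ ^ 2
      = (a - b) ^ 2 + 2 * (a * b) * (1 - Real.cos (u - v)) := by
  rw [← Complex.normSq_eq_norm_sq, Complex.normSq_apply, Complex.exp_mul_I, Complex.exp_mul_I,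
    ← Complex.ofReal_cos, ← Complex.ofReal_sin, ← Complex.ofReal_cos, ← Complex.ofReal_sin]
  simp only [Complex.sub_re, Complex.sub_im, Complex.re_ofReal_mul, Complex.im_ofReal_mul,
    Complex.add_re, Complex.add_im, Complex.re_mul_ofReal, Complex.im_mul_ofReal,
    Complex.ofReal_re, Complex.ofReal_im, Complex.I_re, Complex.I_im, Real.cos_sub]
  linear_combination a ^ 2 * Real.sin_sq_add_cos_sq u + b ^ 2 * Real.sin_sq_add_cos_sq v

/-- The dominating function on the tail. -/
noncomputable def auxDom {d : ℕ} (a b : ℝ) (δ w : EuclideanSpace ℝ (Fin d)) : ℝ :=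
  4 * Real.exp (-(a / 2) * ‖w‖ ^ 2) + 4 * Real.exp (-(b / 2) * ‖w‖ ^ 2)
    - 6 * Real.exp (-((a + b) / 4) * ‖w‖ ^ 2)
    - 2 * (Real.exp (-((a + b) / 4) * ‖w‖ ^ 2) * Real.cos (@inner ℝ _ _ δ w))

theorem auxDom_int {d : ℕ} (a b : ℝ) (ha : 0 < a) (hb : 0 < b) (δ : EuclideanSpace ℝ (Fin d)) :
    Integrable (auxDom a b δ) ∧ ∫ w, auxDom a b δ w =
      4 * (π / (a / 2)) ^ ((d : ℝ) / 2) + 4 * (π / (b / 2)) ^ ((d : ℝ) / 2)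
      - 6 * (π / ((a + b) / 4)) ^ ((d : ℝ) / 2)
      - 2 * ((π / ((a + b) / 4)) ^ ((d : ℝ) / 2) * Real.exp (-‖δ‖ ^ 2 / (4 * ((a + b) / 4)))) := by
  obtain ⟨i1, e1⟩ := aux_exp (d := d) (a / 2) (by positivity)
  obtain ⟨i2, e2⟩ := aux_exp (d := d) (b / 2) (by positivity)
  obtain ⟨i3, e3⟩ := aux_exp (d := d) ((a + b) / 4) (by positivity)
  obtain ⟨i4, e4⟩ := aux_cos ((a + b) / 4) (by positivity) δ
  have j1 := i1.const_mul 4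
  have j2 := i2.const_mul 4
  have j3 := i3.const_mul 6
  have j4 := i4.const_mul 2
  refine ⟨((j1.add j2).sub j3).sub j4, ?_⟩
  unfold auxDom
  refine (integral_sub ((j1.add j2).sub j3) j4).trans ?_
  rw [integral_sub' (j1.add j2) j3, integral_add' j1 j2]
  simp only [integral_const_mul, e1, e2, e3, e4]

theorem auxDom_nonneg {d : ℕ} (a b : ℝ) (δ w : EuclideanSpace ℝ (Fin d)) :
    0 ≤ auxDom a b δ w := by
  have h1 : Real.exp (-(a / 2) * ‖w‖ ^ 2) = Real.exp (-(a / 4) * ‖w‖ ^ 2) ^ 2 := by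
    rw [← Real.exp_nat_mul]; congr 1; push_cast; ring
  have h2 : Real.exp (-(b / 2) * ‖w‖ ^ 2) = Real.exp (-(b / 4) * ‖w‖ ^ 2) ^ 2 := by
    rw [← Real.exp_nat_mul]; congr 1; push_cast; ring
  have h3 : Real.exp (-((a + b) / 4) * ‖w‖ ^ 2)
      = Real.exp (-(a / 4) * ‖w‖ ^ 2) * Real.exp (-(b / 4) * ‖w‖ ^ 2) := by
    rw [← Real.exp_add]; congr 1; ring
  rw [auxDom, h1, h2, h3]
  have hp := mul_pos (Real.exp_pos (-(a / 4) * ‖w‖ ^ 2)) (Real.exp_pos (-(b / 4) * ‖w‖ ^ 2))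
  nlinarith [sq_nonneg (Real.exp (-(a / 4) * ‖w‖ ^ 2) - Real.exp (-(b / 4) * ‖w‖ ^ 2)),
    mul_nonneg hp.le (sub_nonneg.2 (Real.cos_le_one (@inner ℝ _ _ δ w)))]

theorem aux_point (x y E c : ℝ) (hx : 0 < x) (hy : 0 < y) (hxE : x ^ 2 ≤ E) (hyE : y ^ 2 ≤ E)
    (hc : c ≤ 1) :
    (x ^ 2 - y ^ 2) ^ 2 + 2 * (x ^ 2 * y ^ 2) * (1 - c)
      ≤ E * (4 * x ^ 2 + 4 * y ^ 2 - 6 * (x * y) - 2 * (x * y * c)) := by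
  have h1 : (x + y) ^ 2 ≤ 4 * E := by nlinarith [sq_nonneg (x - y)]
  have h2 : x * y ≤ E := by nlinarith [sq_nonneg (x - y)]
  have h3 := mul_le_mul_of_nonneg_right h1 (sq_nonneg (x - y))
  have h4 := mul_le_mul_of_nonneg_right h2
    (mul_nonneg (mul_pos hx hy).le (sub_nonneg.2 hc))
  nlinarith

theorem aux_tail {d : ℕ} (σ₀ σ₁ σ₂ : ℝ)
    (μ₁ μ₂ w : EuclideanSpace ℝ (Fin d))
    (hσ₀ : 0 < σ₀) (hσ₁ : σ₀ ≤ σ₁) (hσ₂ : σ₀ ≤ σ₂)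
    (α : ℝ) (hα : 0 ≤ α) (hw : α ≤ ‖w‖) :
    ‖fourierTf (gaussPdf μ₁ σ₁) w - fourierTf (gaussPdf μ₂ σ₂) w‖ ^ 2
      ≤ Real.exp (-(σ₀ ^ 2 * α ^ 2) / 2) * auxDom (σ₁ ^ 2) (σ₂ ^ 2) (μ₁ - μ₂) w := by
  rw [aux_ft _ _ _ (hσ₀.trans_le hσ₁), aux_ft _ _ _ (hσ₀.trans_le hσ₂), aux_polar]
  have hsq : ∀ s : ℝ, Real.exp (-s ^ 2 * ‖w‖ ^ 2 / 2) = Real.exp (-(s ^ 2 / 4) * ‖w‖ ^ 2) ^ 2 := by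
    intro s; rw [← Real.exp_nat_mul]; congr 1; push_cast; ring
  have hsq' : ∀ s : ℝ, Real.exp (-(s ^ 2 / 2) * ‖w‖ ^ 2) = Real.exp (-(s ^ 2 / 4) * ‖w‖ ^ 2) ^ 2 := by
    intro s; rw [← Real.exp_nat_mul]; congr 1; push_cast; ring
  have h3 : Real.exp (-((σ₁ ^ 2 + σ₂ ^ 2) / 4) * ‖w‖ ^ 2)
      = Real.exp (-(σ₁ ^ 2 / 4) * ‖w‖ ^ 2) * Real.exp (-(σ₂ ^ 2 / 4) * ‖w‖ ^ 2) := by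
    rw [← Real.exp_add]; congr 1; ring
  have hc : Real.cos (-@inner ℝ _ _ μ₁ w - -@inner ℝ _ _ μ₂ w)
      = Real.cos (@inner ℝ _ _ (μ₁ - μ₂) w) := by
    rw [inner_sub_left, ← Real.cos_neg]; congr 1; ring
  have hE : ∀ s : ℝ, σ₀ ≤ s → Real.exp (-(s ^ 2 / 4) * ‖w‖ ^ 2) ^ 2
      ≤ Real.exp (-(σ₀ ^ 2 * α ^ 2) / 2) := by
    intro s hs
    rw [← hsq]
    apply Real.exp_le_exp.2
    have : σ₀ ^ 2 * α ^ 2 ≤ s ^ 2 * ‖w‖ ^ 2 := by gcongr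
    linarith
  rw [auxDom, hsq, hsq, hsq', hsq', h3, hc]
  exact aux_point _ _ _ _ (Real.exp_pos _) (Real.exp_pos _) (hE _ hσ₁) (hE _ hσ₂)
    (Real.cos_le_one _)

/-- Low-frequency property of the restricted isotropic Gaussian family
`{N(μ, σ² I_d) : σ ≥ σ₀}`. -/
theorem gaussian_low_frequency_property {d : ℕ} (σ₀ σ₁ σ₂ : ℝ)
    (μ₁ μ₂ : EuclideanSpace ℝ (Fin d))
    (hσ₀ : 0 < σ₀) (hσ₁ : σ₀ ≤ σ₁) (hσ₂ : σ₀ ≤ σ₂)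
    (α : ℝ) (hα : (1 / σ₀) * Real.sqrt (((d : ℝ) + 4) * Real.log 2) < α) :
    (1 / (2 * π) ^ d) *
        ∫ w in {w : EuclideanSpace ℝ (Fin d) | α ≤ ‖w‖},
          ‖fourierTf (gaussPdf μ₁ σ₁) w - fourierTf (gaussPdf μ₂ σ₂) w‖ ^ 2
      ≤ (2 : ℝ) ^ ((d : ℝ) / 2 + 2) * Real.exp (-(σ₀ ^ 2 * α ^ 2) / 2) *
          ∫ x, (gaussPdf μ₁ σ₁ x - gaussPdf μ₂ σ₂ x) ^ 2 := by
  have h1 : 0 < σ₁ := hσ₀.trans_le hσ₁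
  have h2 : 0 < σ₂ := hσ₀.trans_le hσ₂
  have hα0 : 0 ≤ α := le_trans (by positivity) hα.le
  obtain ⟨iD, eD⟩ := auxDom_int (σ₁ ^ 2) (σ₂ ^ 2) (by positivity) (by positivity) (μ₁ - μ₂)
  set ε := Real.exp (-(σ₀ ^ 2 * α ^ 2) / 2) with hε
  have hεp : 0 < ε := Real.exp_pos _
  have hms : MeasurableSet {w : EuclideanSpace ℝ (Fin d) | α ≤ ‖w‖} :=
    measurableSet_le measurable_const measurable_norm
  have step1 : ∫ w in {w : EuclideanSpace ℝ (Fin d) | α ≤ ‖w‖},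
      ‖fourierTf (gaussPdf μ₁ σ₁) w - fourierTf (gaussPdf μ₂ σ₂) w‖ ^ 2
      ≤ ε * ∫ w, auxDom (σ₁ ^ 2) (σ₂ ^ 2) (μ₁ - μ₂) w := by
    rw [← integral_const_mul]
    refine le_trans ?_ (setIntegral_le_integral (s := {w : EuclideanSpace ℝ (Fin d) | α ≤ ‖w‖})
      (iD.const_mul ε)
      (Filter.Eventually.of_forall fun w => mul_nonneg hεp.le (auxDom_nonneg _ _ _ w)))
    refine integral_mono_of_nonneg (Filter.Eventually.of_forall fun w => sq_nonneg _)
      (iD.const_mul ε).integrableOn ?_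
    filter_upwards [ae_restrict_mem hms] with w hw
    exact aux_tail σ₀ σ₁ σ₂ μ₁ μ₂ w hσ₀ hσ₁ hσ₂ α hα0 hw
  obtain ⟨i11, e11⟩ := aux_prod μ₁ μ₁ σ₁ σ₁ h1 h1
  obtain ⟨i22, e22⟩ := aux_prod μ₂ μ₂ σ₂ σ₂ h2 h2
  obtain ⟨i12, e12⟩ := aux_prod μ₁ μ₂ σ₁ σ₂ h1 h2
  have hR : ∫ x, (gaussPdf μ₁ σ₁ x - gaussPdf μ₂ σ₂ x) ^ 2
      = (∫ x, gaussPdf μ₁ σ₁ x * gaussPdf μ₁ σ₁ x) + (∫ x, gaussPdf μ₂ σ₂ x * gaussPdf μ₂ σ₂ x)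
        - 2 * ∫ x, gaussPdf μ₁ σ₁ x * gaussPdf μ₂ σ₂ x := by
    rw [← integral_const_mul, ← integral_add' i11 i22,
      ← integral_sub' (i11.add i22) (i12.const_mul 2)]
    congr 1; ext x; simp only [Pi.add_apply, Pi.sub_apply]; ring
  rw [hR, e11, e22, e12]
  have hT : (2 : ℝ) ^ ((d : ℝ) / 2 + 2) = 4 * 2 ^ ((d : ℝ) / 2) := by
    rw [Real.rpow_add (by norm_num)]; norm_num; ring
  have hs : ∀ c : ℝ, 0 < c → (π / (c / 2)) ^ ((d : ℝ) / 2)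
      = 2 ^ ((d : ℝ) / 2) * (π / c) ^ ((d : ℝ) / 2) := by
    intro c hc
    rw [← Real.mul_rpow (by norm_num) (by positivity)]
    congr 1; field_simp
  have hq : (σ₁ ^ 2 + σ₂ ^ 2) / 4 = ((σ₁ ^ 2 + σ₂ ^ 2) / 2) / 2 := by ring
  have hE2 : Real.exp (-‖μ₁ - μ₂‖ ^ 2 / (4 * (((σ₁ ^ 2 + σ₂ ^ 2) / 2) / 2)))
      = Real.exp (-‖μ₁ - μ₂‖ ^ 2 / (4 * ((σ₁ ^ 2 + σ₂ ^ 2) / 2))) ^ 2 := by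
    rw [← Real.exp_nat_mul]; congr 1; push_cast; field_simp
  rw [hq, hE2, hs (σ₁ ^ 2) (by positivity), hs (σ₂ ^ 2) (by positivity),
    hs ((σ₁ ^ 2 + σ₂ ^ 2) / 2) (by positivity)] at eD
  rw [hT, sub_self, sub_self, add_self_div_two, add_self_div_two]
  simp only [norm_zero, ne_eq, OfNat.ofNat_ne_zero, not_false_eq_true, zero_pow, neg_zero, zero_div,
    Real.exp_zero, mul_one]
  have hE1 : Real.exp (-‖μ₁ - μ₂‖ ^ 2 / (4 * ((σ₁ ^ 2 + σ₂ ^ 2) / 2))) ≤ 1 := by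
    rw [Real.exp_le_one_iff, neg_div]
    have : 0 ≤ ‖μ₁ - μ₂‖ ^ 2 / (4 * ((σ₁ ^ 2 + σ₂ ^ 2) / 2)) := by positivity
    linarith
  have hE0 := Real.exp_pos (-‖μ₁ - μ₂‖ ^ 2 / (4 * ((σ₁ ^ 2 + σ₂ ^ 2) / 2)))
  generalize Real.exp (-‖μ₁ - μ₂‖ ^ 2 / (4 * ((σ₁ ^ 2 + σ₂ ^ 2) / 2))) = E at *
  have hC : 0 < (π / ((σ₁ ^ 2 + σ₂ ^ 2) / 2)) ^ ((d : ℝ) / 2) := by positivity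
  have hK : (0 : ℝ) < 2 ^ ((d : ℝ) / 2) := by positivity
  generalize (π / ((σ₁ ^ 2 + σ₂ ^ 2) / 2)) ^ ((d : ℝ) / 2) = C at *
  generalize (2 : ℝ) ^ ((d : ℝ) / 2) = K at *
  generalize (π / σ₁ ^ 2) ^ ((d : ℝ) / 2) = A at *
  generalize (π / σ₂ ^ 2) ^ ((d : ℝ) / 2) = B at *
  have hN : 0 < 1 / (2 * π) ^ d := by positivity
  have fin : ∫ w, auxDom (σ₁ ^ 2) (σ₂ ^ 2) (μ₁ - μ₂) w ≤ 4 * K * (A + B - 2 * (C * E)) := by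
    rw [eD]
    have : 0 ≤ 2 * (K * C) * ((1 - E) * (3 - E)) :=
      mul_nonneg (by positivity) (mul_nonneg (by linarith) (by linarith))
    nlinarith
  calc _ ≤ 1 / (2 * π) ^ d * (ε * (4 * K * (A + B - 2 * (C * E)))) :=
        mul_le_mul_of_nonneg_left
          (step1.trans (mul_le_mul_of_nonneg_left fin hεp.le)) hN.le
    _ = _ := by ring
end

section
/- For k ∈ ℕ, k ≥ 1, let p_k(x) = (1 + sin(kx))/(2π) and q_k(x) = (1 − sin(kx))/(2π) for x ∈ [0, 2π] (both zero outside [0, 2π]), with Fourier transforms P_k, Q_k. Then this family fails the low-frequency property: for every α ≥ 0 and every ξ < 1 there exists k ∈ ℕ with k > α such that ∫_{|ω| ≥ α} |P_k(ω) − Q_k(ω)|² dω > ξ · 2π · ‖p_k − q_k‖₂². In fact, for k > α one has ∫_{|ω| ≥ α} |P_k(ω) − Q_k(ω)|² dω ≥ 2π‖p_k − q_k‖₂² − 8k²α/(π²(k² − α²)²), and ‖p_k − q_k‖₂² = 1/π. -/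
open MeasureTheory Real

/-- Fourier transform on `ℝ` with the convention `F{f}(w) = ∫ f(x) e^{-ixw} dx`. -/
noncomputable def fourierTf1 (f : ℝ → ℝ) (w : ℝ) : ℂ :=
  ∫ x, (f x : ℂ) * Complex.exp (-Complex.I * ((x * w : ℝ) : ℂ))

/-- `p_k(x) = (1 + sin(kx))/(2π)` on `[0, 2π]`, zero elsewhere. -/
noncomputable def pf (k : ℕ) (x : ℝ) : ℝ :=
  Set.indicator (Set.Icc 0 (2 * π)) (fun y => (1 + Real.sin (k * y)) / (2 * π)) x

/-- `q_k(x) = (1 − sin(kx))/(2π)` on `[0, 2π]`, zero elsewhere. -/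
noncomputable def qf (k : ℕ) (x : ℝ) : ℝ :=
  Set.indicator (Set.Icc 0 (2 * π)) (fun y => (1 - Real.sin (k * y)) / (2 * π)) x

/-- The Fourier transform of `p_k - q_k` as an interval integral. -/
noncomputable def gf (k : ℕ) (w : ℝ) : ℂ :=
  ∫ x in (0:ℝ)..(2 * π), ((Real.sin (k * x) / π : ℝ) : ℂ) *
    Complex.exp (-Complex.I * ((x * w : ℝ) : ℂ))

lemma tf_indicator (g : ℝ → ℝ) (w : ℝ) :
    fourierTf1 (fun x => Set.indicator (Set.Icc 0 (2 * π)) g x) w =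
      ∫ x in (0:ℝ)..(2 * π), (g x : ℂ) * Complex.exp (-Complex.I * ((x * w : ℝ) : ℂ)) := by
  have hpi := Real.pi_pos
  rw [intervalIntegral.integral_of_le (by positivity), ← integral_Icc_eq_integral_Ioc,
    ← integral_indicator measurableSet_Icc, fourierTf1]
  congr 1
  ext x
  by_cases hx : x ∈ Set.Icc 0 (2 * π) <;> simp [hx]

lemma tf_sub (k : ℕ) (w : ℝ) : fourierTf1 (pf k) w - fourierTf1 (qf k) w = gf k w := by
  have h1 := tf_indicator (fun y => (1 + Real.sin (k * y)) / (2 * π)) w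
  have h2 := tf_indicator (fun y => (1 - Real.sin (k * y)) / (2 * π)) w
  have e1 : pf k = fun x => Set.indicator (Set.Icc 0 (2 * π))
    (fun y => (1 + Real.sin (k * y)) / (2 * π)) x := rfl
  have e2 : qf k = fun x => Set.indicator (Set.Icc 0 (2 * π))
    (fun y => (1 - Real.sin (k * y)) / (2 * π)) x := rfl
  rw [e1, e2, h1, h2, gf, ← intervalIntegral.integral_sub]
  · congr 1
    ext x
    rw [← sub_mul, ← Complex.ofReal_sub]
    congr 2
    have := Real.pi_ne_zero
    field_simp
    ring
  · exact Continuous.intervalIntegrable (by fun_prop) _ _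
  · exact Continuous.intervalIntegrable (by fun_prop) _ _

lemma gf_continuous (k : ℕ) : Continuous (gf k) := by
  unfold gf
  apply intervalIntegral.continuous_parametric_intervalIntegral_of_continuous'
  unfold Function.uncurry
  fun_prop

lemma int_sin_sq (k : ℕ) (hk : 1 ≤ k) :
    ∫ x in (0:ℝ)..(2 * π), (Real.sin (k * x) / π) ^ 2 = 1 / π := by
  have hk0 : (k : ℝ) ≠ 0 := by positivity
  have hpi := Real.pi_ne_zero
  have := intervalIntegral.integral_comp_mul_left (fun x => Real.sin x ^ 2) hk0
    (a := 0) (b := 2 * π)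
  simp_rw [div_pow]
  rw [intervalIntegral.integral_div, this, integral_sin_sq]
  have h2 : Real.sin (k * (2 * π)) = 0 := by
    have := Real.sin_nat_mul_pi (k * 2)
    push_cast at this
    rwa [mul_assoc] at this
  simp [h2]
  field_simp

lemma l2_norm (k : ℕ) (hk : 1 ≤ k) : (∫ x, (pf k x - qf k x) ^ 2) = 1 / π := by
  have hpi := Real.pi_pos
  rw [← int_sin_sq k hk, intervalIntegral.integral_of_le (by positivity),
    ← integral_Icc_eq_integral_Ioc, ← integral_indicator measurableSet_Icc]
  congr 1
  ext x
  by_cases hx : x ∈ Set.Icc 0 (2 * π)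
  · simp only [pf, qf, hx, Set.indicator_of_mem]
    field_simp
    ring
  · simp [pf, qf, hx]

lemma gf_hasSum (k : ℕ) (hk : 1 ≤ k) (w : ℝ) :
    HasSum (fun n : ℤ => ‖gf k (w + n)‖ ^ 2) 2 := by
  have hpi := Real.pi_pos
  have hab : (0:ℝ) < 2 * π := by positivity
  have hc : Continuous (fun x : ℝ => ((Real.sin (k * x) / π : ℝ) : ℂ) *
    Complex.exp (-Complex.I * ((x * w : ℝ) : ℂ))) := by fun_prop
  have hL : MemLp (fun x : ℝ => ((Real.sin (k * x) / π : ℝ) : ℂ) *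
    Complex.exp (-Complex.I * ((x * w : ℝ) : ℂ))) 2 (volume.restrict (Set.Ioc 0 (2 * π))) := by
    rw [memLp_two_iff_integrable_sq_norm hc.aestronglyMeasurable]
    have : Continuous (fun x : ℝ => ‖((Real.sin (k * x) / π : ℝ) : ℂ) *
      Complex.exp (-Complex.I * ((x * w : ℝ) : ℂ))‖ ^ 2) := by fun_prop
    exact (this.integrableOn_Icc (a := 0) (b := 2 * π)).mono_set Set.Ioc_subset_Icc_self
  have h := (hasSum_sq_fourierCoeffOn hab hL).mul_left ((2 * π) ^ 2)
  have e : ∀ x : ℝ, ‖((Real.sin (k * x) / π : ℝ) : ℂ) *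
      Complex.exp (-Complex.I * ((x * w : ℝ) : ℂ))‖ ^ 2 = (Real.sin (k * x) / π) ^ 2 := by
    intro x
    have : -Complex.I * ((x * w : ℝ) : ℂ) = ((-(x * w) : ℝ) : ℂ) * Complex.I := by
      push_cast; ring
    rw [norm_mul, this, Complex.norm_exp_ofReal_mul_I, Complex.norm_real,
      mul_one, Real.norm_eq_abs, sq_abs]
  simp_rw [e] at h
  rw [int_sin_sq k hk] at h
  have hv : (2 * π) ^ 2 * (2 * π - 0)⁻¹ • (1 / π) = 2 := by
    rw [sub_zero, smul_eq_mul]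
    field_simp
    try norm_num
  rw [hv] at h
  have hfun : (fun n : ℤ => ‖gf k (w + n)‖ ^ 2) = (fun i : ℤ => (2 * π) ^ 2 *
      ‖fourierCoeffOn hab (fun x : ℝ => ((Real.sin (k * x) / π : ℝ) : ℂ) *
        Complex.exp (-Complex.I * ((x * w : ℝ) : ℂ))) i‖ ^ 2) := by
    funext n
    rw [fourierCoeffOn_eq_integral, norm_smul, sub_zero, ← mul_pow, ← mul_assoc]
    have : 2 * π * ‖1 / (2 * π)‖ = 1 := by
      rw [Real.norm_of_nonneg (by positivity)]; field_simp
    rw [this, one_mul, gf]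
    congr 2
    apply intervalIntegral.integral_congr
    intro x _
    simp only [fourier_coe_apply, smul_eq_mul]
    rw [mul_left_comm, ← Complex.exp_add]
    congr 2
    have : (π : ℂ) ≠ 0 := by exact_mod_cast hpi.ne'
    push_cast
    field_simp
    ring
  rw [hfun]
  exact h

lemma gf_lintegral (k : ℕ) (hk : 1 ≤ k) :
    ∫⁻ w, ENNReal.ofReal (‖gf k w‖ ^ 2) = ENNReal.ofReal 2 := by
  have hG := gf_continuous k
  have hm : ∀ n : ℤ, ∫⁻ w in Set.Ioc ((0:ℝ) + n) (0 + n + 1), ENNReal.ofReal (‖gf k w‖ ^ 2) =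
      ∫⁻ w in Set.Ioc (0:ℝ) 1, ENNReal.ofReal (‖gf k (w + n)‖ ^ 2) := by
    intro n
    have := (measurePreserving_add_right volume (n : ℝ)).setLIntegral_comp_preimage
      (s := Set.Ioc ((0:ℝ) + n) (0 + n + 1)) measurableSet_Ioc
      (f := fun w => ENNReal.ofReal (‖gf k w‖ ^ 2)) (by fun_prop)
    rw [← this]
    congr 2
    ext x
    simp only [Set.mem_preimage, Set.mem_Ioc]
    constructor <;> rintro ⟨h1, h2⟩ <;> constructor <;> linarith
  rw [← setLIntegral_univ, ← iUnion_Ioc_add_intCast (0:ℝ),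
    lintegral_iUnion (fun _ => measurableSet_Ioc) (Set.pairwise_disjoint_Ioc_add_intCast (0:ℝ))]
  simp_rw [hm]
  rw [← lintegral_tsum (fun n => by fun_prop)]
  have : ∀ w : ℝ, ∑' n : ℤ, ENNReal.ofReal (‖gf k (w + n)‖ ^ 2) = ENNReal.ofReal 2 := by
    intro w
    have h := gf_hasSum k hk w
    rw [← ENNReal.ofReal_tsum_of_nonneg (fun n => by positivity) h.summable, h.tsum_eq]
  simp_rw [this]
  simp

lemma gf_integrable (k : ℕ) (hk : 1 ≤ k) : Integrable (fun w => ‖gf k w‖ ^ 2) := by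
  have hG := gf_continuous k
  refine ⟨by fun_prop, ?_⟩
  rw [hasFiniteIntegral_iff_ofReal (Filter.Eventually.of_forall fun w => by positivity),
    gf_lintegral k hk]
  exact ENNReal.ofReal_lt_top

lemma gf_integral (k : ℕ) (hk : 1 ≤ k) : ∫ w, ‖gf k w‖ ^ 2 = 2 := by
  rw [integral_eq_lintegral_of_nonneg_ae (Filter.Eventually.of_forall fun w => by positivity)
    (gf_integrable k hk).1, gf_lintegral k hk]
  simp

lemma gf_closed (k : ℕ) (w : ℝ) :
    ((k : ℂ) ^ 2 - (w : ℂ) ^ 2) * gf k w =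
      (k : ℂ) / π * (1 - Complex.exp (-Complex.I * ((2 * π * w : ℝ) : ℂ))) := by
  have hpi : (π : ℂ) ≠ 0 := by exact_mod_cast Real.pi_ne_zero
  have hd : ∀ x ∈ Set.uIcc (0:ℝ) (2 * π), HasDerivAt (fun x : ℝ =>
      Complex.exp (-Complex.I * ((x * w : ℝ) : ℂ)) *
      (-(k : ℂ) * ((Real.cos (k * x) : ℝ) : ℂ) + -(Complex.I * w) * ((Real.sin (k * x) : ℝ) : ℂ)) / π)
      (((k : ℂ) ^ 2 - (w : ℂ) ^ 2) * (((Real.sin (k * x) / π : ℝ) : ℂ) *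
        Complex.exp (-Complex.I * ((x * w : ℝ) : ℂ)))) x := by
    intro x _
    have h0 : HasDerivAt (fun x : ℝ => (k : ℝ) * x) k x := by
      simpa using (hasDerivAt_id x).const_mul (k : ℝ)
    have hw : HasDerivAt (fun x : ℝ => x * w) w x := by
      simpa using (hasDerivAt_id x).mul_const w
    have h1 := h0.cos.ofReal_comp
    have h2 := h0.sin.ofReal_comp
    have h3 := (hw.ofReal_comp.const_mul (-Complex.I)).cexp
    have h4 := (h3.mul ((h1.const_mul (-(k : ℂ))).add (h2.const_mul (-(Complex.I * w))))).div_const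
      (π : ℂ)
    refine HasDerivAt.congr_deriv h4 ?_
    simp only [Pi.add_apply]
    push_cast
    field_simp
    ring_nf
    simp only [Complex.I_sq]
    ring
  have := intervalIntegral.integral_eq_sub_of_hasDerivAt hd
    (Continuous.intervalIntegrable (by fun_prop) _ _)
  rw [gf, ← intervalIntegral.integral_const_mul, this]
  have h2 : Real.sin (k * (2 * π)) = 0 := by
    have := Real.sin_nat_mul_pi (k * 2)
    push_cast at this
    rwa [mul_assoc] at this
  have h3 : Real.cos (k * (2 * π)) = 1 := Real.cos_nat_mul_two_pi k
  rw [h2, h3]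
  simp
  field_simp
  ring

lemma gf_bound (k : ℕ) (α w : ℝ) (hα : 0 ≤ α) (hk : α < k) (hw : |w| < α) :
    ‖gf k w‖ ^ 2 ≤ 4 * (k : ℝ) ^ 2 / (π ^ 2 * ((k : ℝ) ^ 2 - α ^ 2) ^ 2) := by
  have hpi := Real.pi_pos
  have hwa : w ^ 2 ≤ α ^ 2 := by rw [← sq_abs w]; gcongr
  have hka : 0 < (k : ℝ) ^ 2 - α ^ 2 := by nlinarith
  have h := congrArg norm (gf_closed k w)
  have e : -Complex.I * ((2 * π * w : ℝ) : ℂ) = ((-(2 * π * w) : ℝ) : ℂ) * Complex.I := by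
    push_cast; ring
  have e2 : ((k : ℂ) ^ 2 - (w : ℂ) ^ 2) = (((k : ℝ) ^ 2 - w ^ 2 : ℝ) : ℂ) := by push_cast; ring
  have h5 : ‖(1 : ℂ) - Complex.exp (-Complex.I * ((2 * π * w : ℝ) : ℂ))‖ ≤ 2 := by
    refine (norm_sub_le _ _).trans ?_
    rw [e, Complex.norm_exp_ofReal_mul_I]
    norm_num
  rw [norm_mul, norm_mul, e2, Complex.norm_real, Real.norm_of_nonneg (by linarith)] at h
  have e3 : ‖(k : ℂ) / (π : ℂ)‖ = k / π := by
    rw [norm_div, Complex.norm_natCast, Complex.norm_real, Real.norm_of_nonneg hpi.le]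
  rw [e3] at h
  have h6 : ((k : ℝ) ^ 2 - α ^ 2) * ‖gf k w‖ ≤ k / π * 2 := by
    calc _ ≤ ((k : ℝ) ^ 2 - w ^ 2) * ‖gf k w‖ := by gcongr
      _ = _ := h
      _ ≤ _ := by gcongr
  have h7 : ‖gf k w‖ ≤ (k / π * 2) / ((k : ℝ) ^ 2 - α ^ 2) := by
    rw [le_div_iff₀ hka]; linarith
  calc _ ≤ ((k / π * 2) / ((k : ℝ) ^ 2 - α ^ 2)) ^ 2 := by gcongr
    _ = _ := by field_simp; norm_num

lemma high_bound (α : ℝ) (hα : 0 ≤ α) (k : ℕ) (hk : 1 ≤ k) (hak : α < (k : ℝ)) :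
    2 - 8 * (k : ℝ) ^ 2 * α / (π ^ 2 * ((k : ℝ) ^ 2 - α ^ 2) ^ 2)
      ≤ ∫ ω in {ω : ℝ | α ≤ |ω|}, ‖gf k ω‖ ^ 2 := by
  have hs : MeasurableSet {ω : ℝ | α ≤ |ω|} :=
    measurableSet_le measurable_const (by fun_prop)
  have hsplit := integral_add_compl hs (gf_integrable k hk)
  rw [gf_integral k hk] at hsplit
  have hc : {ω : ℝ | α ≤ |ω|}ᶜ = Set.Ioo (-α) α := by
    ext x; simp [abs_lt]
  rw [hc] at hsplit
  have hb : ∫ ω in Set.Ioo (-α) α, ‖gf k ω‖ ^ 2 ≤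
      ∫ ω in Set.Ioo (-α) α, 4 * (k : ℝ) ^ 2 / (π ^ 2 * ((k : ℝ) ^ 2 - α ^ 2) ^ 2) := by
    apply setIntegral_mono_on (gf_integrable k hk).integrableOn _ measurableSet_Ioo
    · intro x hx
      exact gf_bound k α x hα hak (abs_lt.2 hx)
    · exact integrableOn_const (by simp)
  rw [setIntegral_const, measureReal_def, Real.volume_Ioo,
    ENNReal.toReal_ofReal (by linarith), smul_eq_mul] at hb
  have : (α - -α) * (4 * (k : ℝ) ^ 2 / (π ^ 2 * ((k : ℝ) ^ 2 - α ^ 2) ^ 2)) =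
      8 * (k : ℝ) ^ 2 * α / (π ^ 2 * ((k : ℝ) ^ 2 - α ^ 2) ^ 2) := by ring
  linarith

lemma err_small (α ξ : ℝ) (hα : 0 ≤ α) (hξ : ξ < 1) : ∃ k : ℕ, 1 ≤ k ∧ α < (k : ℝ) ∧
    8 * (k : ℝ) ^ 2 * α / (π ^ 2 * ((k : ℝ) ^ 2 - α ^ 2) ^ 2) < 2 * (1 - ξ) := by
  obtain ⟨k, hk⟩ := exists_nat_gt (2 * α + 1 + α / (1 - ξ))
  have h1 : 0 ≤ α / (1 - ξ) := div_nonneg hα (by linarith)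
  have hk1 : (1 : ℝ) ≤ k := by linarith
  refine ⟨k, by exact_mod_cast hk1, by linarith, ?_⟩
  have h2 : α < k * (1 - ξ) := by
    rw [← div_lt_iff₀ (by linarith)]; linarith
  have h3 : 3 / 4 * (k : ℝ) ^ 2 ≤ (k : ℝ) ^ 2 - α ^ 2 := by nlinarith
  have hp : (9 : ℝ) ≤ π ^ 2 := by nlinarith [Real.pi_gt_three]
  have h4 : 9 * (3 / 4 * (k : ℝ) ^ 2) ^ 2 ≤ π ^ 2 * ((k : ℝ) ^ 2 - α ^ 2) ^ 2 := by gcongr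
  calc _ ≤ 8 * (k : ℝ) ^ 2 * α / (9 * (3 / 4 * (k : ℝ) ^ 2) ^ 2) := by gcongr
    _ = 128 / 81 * (α / (k : ℝ) ^ 2) := by field_simp; ring
    _ ≤ 2 * (α / k) := by
      have : α / (k : ℝ) ^ 2 ≤ α / k := by
        gcongr
        nlinarith
      have : 0 ≤ α / k := by positivity
      linarith
    _ < _ := by
      have : α / k < 1 - ξ := by
        rw [div_lt_iff₀ (by linarith)]; linarith
      linarith

/-- The family `{p_k, q_k}` fails the low-frequency property: for every `α ≥ 0` and `ξ < 1`
there is `k > α` whose high-frequency energy exceeds `ξ·2π·‖p_k − q_k‖₂²`; moreover an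
explicit lower bound on the high-frequency energy holds for `k > α`, and
`‖p_k − q_k‖₂² = 1/π`. -/
theorem sine_family_fails_low_frequency :
    (∀ α : ℝ, 0 ≤ α → ∀ ξ : ℝ, ξ < 1 → ∃ k : ℕ, α < (k : ℝ) ∧
      ξ * (2 * π) * (∫ x, (pf k x - qf k x) ^ 2)
        < ∫ ω in {ω : ℝ | α ≤ |ω|}, ‖fourierTf1 (pf k) ω - fourierTf1 (qf k) ω‖ ^ 2)
    ∧ (∀ α : ℝ, 0 ≤ α → ∀ k : ℕ, 1 ≤ k → α < (k : ℝ) →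
      2 * π * (∫ x, (pf k x - qf k x) ^ 2)
          - 8 * (k : ℝ) ^ 2 * α / (π ^ 2 * ((k : ℝ) ^ 2 - α ^ 2) ^ 2)
        ≤ ∫ ω in {ω : ℝ | α ≤ |ω|}, ‖fourierTf1 (pf k) ω - fourierTf1 (qf k) ω‖ ^ 2)
    ∧ (∀ k : ℕ, 1 ≤ k → (∫ x, (pf k x - qf k x) ^ 2) = 1 / π) := by
  have h2pi : 2 * π * (1 / π) = 2 := by
    have := Real.pi_ne_zero
    field_simp
  simp_rw [tf_sub]
  refine ⟨?_, ?_, l2_norm⟩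
  · intro α hα ξ hξ
    obtain ⟨k, hk, hak, he⟩ := err_small α ξ hα hξ
    refine ⟨k, hak, ?_⟩
    have := high_bound α hα k hk hak
    rw [l2_norm k hk, mul_assoc, h2pi]
    linarith
  · intro α hα k hk hak
    rw [l2_norm k hk, h2pi]
    exact high_bound α hα k hk hak
end
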